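/- arXiv:2007.06399 — 4 statements merged into one kernel-verified Lean document; each statement's English description precedes it below -/
import Mathlib

section
/- Let G be a connected simple graph of order n ≥ 3 with vertex set {v_1, ..., v_n}, and let s_1, ..., s_n be integers with s_i ≥ 2 for all i = 1, ..., n. Then d(G) ≤ d̄(G(s_1, ..., s_n)) ≤ d(G) + 2, where d(G) denotes the diameter of G. -/
open SimpleGraph

variable {V : Type*}

/-- `D` is an orientation of `G`: every arc of `D` is an edge of `G`, and every edge of `G`
receives exactly one of the two possible directions. -/
def IsOrientation (G : SimpleGraph V) (D : V → V → Prop) : Prop :=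
  (∀ u v, D u v → G.Adj u v) ∧ ∀ u v, G.Adj u v → (D u v ↔ ¬ D v u)

/-- There is a directed walk of length `n` from `u` to `v` in the digraph `D`. -/
def DPath (D : V → V → Prop) : ℕ → V → V → Prop
  | 0, u, v => u = v
  | n + 1, u, v => ∃ w, D u w ∧ DPath D n w v

/-- Directed distance from `u` to `v` (`⊤` if `v` is not reachable from `u`). -/
noncomputable def ddist (D : V → V → Prop) (u v : V) : ℕ∞ :=
  sInf {n : ℕ∞ | ∃ m : ℕ, n = (m : ℕ∞) ∧ DPath D m u v}

/-- Diameter of a digraph: supremum of directed distances over all ordered pairs. -/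
noncomputable def odiam (D : V → V → Prop) : ℕ∞ :=
  ⨆ u : V, ⨆ v : V, ddist D u v

/-- A strong orientation of `G`: an orientation in which every vertex is reachable
from every other vertex by a directed path. -/
def IsStrongOrientation (G : SimpleGraph V) (D : V → V → Prop) : Prop :=
  IsOrientation G D ∧ ∀ u v, ∃ m : ℕ, DPath D m u v

/-- The orientation number of `G`: minimum diameter over all strong orientations. -/
noncomputable def orientNum (G : SimpleGraph V) : ℕ∞ :=
  sInf {d : ℕ∞ | ∃ D : V → V → Prop, IsStrongOrientation G D ∧ d = odiam D}

/-- The vertex-multiplication `G(s)`: vertex `v` is replaced by `s v` copies, and copies of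
`v_i`, `v_j` are adjacent iff `v_i v_j` is an edge of `G` (whence `i ≠ j`). -/
def vertexMult (G : SimpleGraph V) (s : V → ℕ) : SimpleGraph (Σ v : V, Fin (s v)) where
  Adj x y := G.Adj x.1 y.1
  symm := ⟨fun _ _ h => G.symm.symm _ _ h⟩
  loopless := ⟨fun x h => G.loopless.irrefl x.1 h⟩

/-- Eccentricity of a vertex. -/
noncomputable def ecc (G : SimpleGraph V) (v : V) : ℕ∞ :=
  ⨆ u : V, G.edist v u

theorem ddist_le_of_dPath {W : Type*} {D : W → W → Prop} {m : ℕ} {x y : W}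
    (h : DPath D m x y) : ddist D x y ≤ m :=
  sInf_le ⟨m, rfl, h⟩

/-- Directed paths in an orientation of a vertex-multiplication project to walks of `G`. -/
theorem edist_le_of_dPath {G : SimpleGraph V} {s : V → ℕ}
    {D : (Σ v : V, Fin (s v)) → (Σ v : V, Fin (s v)) → Prop}
    (hD : ∀ x y, D x y → (vertexMult G s).Adj x y) {m : ℕ} {x y : Σ v : V, Fin (s v)}
    (h : DPath D m x y) : G.edist x.1 y.1 ≤ m := by
  induction m generalizing x with
  | zero =>
    obtain rfl : x = y := h
    simp
  | succ m ih =>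
    obtain ⟨z, hxz, hzy⟩ := h
    have hadj : G.Adj x.1 z.1 := hD _ _ hxz
    calc G.edist x.1 y.1 ≤ G.edist x.1 z.1 + G.edist z.1 y.1 := G.edist_triangle
      _ ≤ 1 + m := add_le_add (edist_eq_one_iff_adj.2 hadj).le (ih hzy)
      _ = ((m + 1 : ℕ) : ℕ∞) := by push_cast; ring

theorem ediam_le_orientNum_vertexMult (G : SimpleGraph V) {s : V → ℕ} (hs : ∀ v, 0 < s v) :
    G.ediam ≤ orientNum (vertexMult G s) := by
  refine le_sInf ?_
  rintro _ ⟨D, hD, rfl⟩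
  refine ediam_le_of_edist_le fun u v => ?_
  have hle : G.edist u v ≤ ddist D ⟨u, ⟨0, hs u⟩⟩ ⟨v, ⟨0, hs v⟩⟩ := by
    refine le_sInf ?_
    rintro _ ⟨m, rfl, hm⟩
    exact edist_le_of_dPath hD.1.1 hm
  exact hle.trans (le_iSup₂_of_le _ _ le_rfl)

/-- The sum in `Bool` (that is, modulo 2) of the gains `g a b` over the steps `a, b` of a walk. -/
def walkGain {G : SimpleGraph V} (g : V → V → Bool) : {u v : V} → G.Walk u v → Bool
  | _, _, .nil => false
  | u, _, .cons (v := w) _ p => xor (g u w) (walkGain g p)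

/-- Whether a vertex of a vertex-multiplication is the zeroth copy. -/
def copyClass {s : V → ℕ} (x : Σ v : V, Fin (s v)) : Bool := decide (x.2.val = 0)

theorem exists_copyClass_eq {s : V → ℕ} (hs : ∀ v, 2 ≤ s v) (v : V) (b : Bool) :
    ∃ i : Fin (s v), copyClass (⟨v, i⟩ : Σ v : V, Fin (s v)) = b := by
  have := hs v
  cases b
  · exact ⟨⟨1, by omega⟩, by simp [copyClass]⟩
  · exact ⟨⟨0, by omega⟩, by simp [copyClass]⟩

/-- The digraph on a vertex-multiplication in which a step along `u, v` changes the copy class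
by `g u v`. -/
def gainDigraph (G : SimpleGraph V) (s : V → ℕ) (g : V → V → Bool)
    (x y : Σ v : V, Fin (s v)) : Prop :=
  G.Adj x.1 y.1 ∧ copyClass y = xor (copyClass x) (g x.1 y.1)

theorem isOrientation_gainDigraph {G : SimpleGraph V} (s : V → ℕ) {g : V → V → Bool}
    (hg : ∀ u v, G.Adj u v → g v u = !g u v) :
    IsOrientation (vertexMult G s) (gainDigraph G s g) := by
  refine ⟨fun x y h => h.1, fun x y h => ?_⟩
  have hxy : G.Adj x.1 y.1 := h
  simp only [gainDigraph, hxy, hxy.symm, true_and, hg _ _ hxy]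
  cases copyClass x <;> cases copyClass y <;> cases g x.1 y.1 <;> simp

/-- A nonempty walk lifts to a directed path between any copies of its endpoints whose classes
differ by the gain of the walk. -/
theorem dPath_gainDigraph_cons {G : SimpleGraph V} {s : V → ℕ} (hs : ∀ v, 2 ≤ s v)
    (g : V → V → Bool) {u w v : V} (h : G.Adj u w) (p : G.Walk w v)
    (i : Fin (s u)) (j : Fin (s v))
    (hij : copyClass (⟨v, j⟩ : Σ v : V, Fin (s v)) =
      xor (copyClass (⟨u, i⟩ : Σ v : V, Fin (s v))) (walkGain g (.cons h p))) :
    DPath (gainDigraph G s g) (p.length + 1) ⟨u, i⟩ ⟨v, j⟩ := by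
  induction p generalizing u with
  | nil => exact ⟨_, ⟨h, by simpa [walkGain] using hij⟩, rfl⟩
  | @cons w z v h' p ih =>
    obtain ⟨k, hk⟩ := exists_copyClass_eq hs w
      (xor (copyClass (⟨u, i⟩ : Σ v : V, Fin (s v))) (g u w))
    refine ⟨⟨w, k⟩, ⟨h, hk⟩, ih h' k j ?_⟩
    rw [hij, hk]
    simp [walkGain]

/-- A connected graph on at least three vertices has diameter at least two, or every vertex lies
in a triangle. -/
theorem two_le_ediam_or_exists_triangle [Fintype V] (G : SimpleGraph V)
    (hn : 3 ≤ Fintype.card V) (u : V) :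
    2 ≤ G.ediam ∨ ∃ w z, G.Adj u w ∧ G.Adj w z ∧ G.Adj z u := by
  classical
  by_cases hd : ∀ a b, a ≠ b → G.Adj a b
  · right
    have h₁ : ∃ w, w ∉ ({u} : Finset V) := by
      by_contra! h
      have := Finset.card_le_card (fun x _ => h x : Finset.univ ⊆ ({u} : Finset V))
      simp at this
      omega
    obtain ⟨w, hw⟩ := h₁
    have h₂ : ∃ z, z ∉ ({u, w} : Finset V) := by
      by_contra! h
      have := Finset.card_le_card (fun x _ => h x : Finset.univ ⊆ ({u, w} : Finset V))
      have := this.trans Finset.card_le_two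
      rw [Finset.card_univ] at this
      omega
    obtain ⟨z, hz⟩ := h₂
    simp only [Finset.mem_insert, Finset.mem_singleton, not_or] at hw hz
    exact ⟨w, z, hd _ _ (Ne.symm hw), hd _ _ (Ne.symm hz.2), hd _ _ hz.1⟩
  · left
    push Not at hd
    obtain ⟨a, b, hab, hnadj⟩ := hd
    refine le_trans ?_ (G.edist_le_ediam (u := a) (v := b))
    have h₀ : 0 < G.edist a b := edist_pos_of_ne hab
    have h₁ : G.edist a b ≠ 1 := fun h => hnadj (edist_eq_one_iff_adj.1 h)
    have h₁' : 1 < G.edist a b := lt_of_le_of_ne (Order.one_le_iff_pos.2 h₀) (Ne.symm h₁)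
    simpa [one_add_one_eq_two] using Order.add_one_le_of_lt h₁'

theorem exists_dPath_gainDigraph_le [Fintype V] {G : SimpleGraph V} (hG : G.Connected)
    (hn : 3 ≤ Fintype.card V) {s : V → ℕ} (hs : ∀ v, 2 ≤ s v) {g : V → V → Bool}
    (hg : ∀ u v, G.Adj u v → g v u = !g u v) (x y : Σ v : V, Fin (s v)) :
    ∃ m : ℕ, (m : ℕ∞) ≤ G.ediam + 2 ∧ DPath (gainDigraph G s g) m x y := by
  obtain ⟨u, i⟩ := x
  obtain ⟨v, j⟩ := y
  by_cases huv : u = v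
  · subst huv
    by_cases hc : copyClass (⟨u, j⟩ : Σ v : V, Fin (s v)) = copyClass ⟨u, i⟩
    · rcases two_le_ediam_or_exists_triangle G hn u with hd | ⟨w, z, huw, hwz, hzu⟩
      · have : Nontrivial V := Fintype.one_lt_card_iff_nontrivial.1 (by omega)
        obtain ⟨w, h⟩ := hG.preconnected.exists_adj_of_nontrivial u
        refine ⟨4, ?_, dPath_gainDigraph_cons hs g h
          (.cons h.symm (.cons h (.cons h.symm .nil))) i j ?_⟩
        · calc ((4 : ℕ) : ℕ∞) = 2 + 2 := by norm_num
            _ ≤ _ := by gcongr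
        · simp [walkGain, hc, hg _ _ h]
      · have hd : 1 ≤ G.ediam :=
          (edist_eq_one_iff_adj.2 huw).ge.trans G.edist_le_ediam
        have hm : ((3 : ℕ) : ℕ∞) ≤ G.ediam + 2 :=
          calc ((3 : ℕ) : ℕ∞) = 1 + 2 := by norm_num
            _ ≤ _ := by gcongr
        by_cases ht : walkGain g (.cons huw (.cons hwz (.cons hzu .nil))) = false
        · exact ⟨3, hm, dPath_gainDigraph_cons hs g huw (.cons hwz (.cons hzu .nil)) i j
            (by simp [ht, hc])⟩
        · refine ⟨3, hm, dPath_gainDigraph_cons hs g hzu.symm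
            (.cons hwz.symm (.cons huw.symm .nil)) i j ?_⟩
          simp only [walkGain, hc, hg _ _ huw, hg _ _ hwz, hg _ _ hzu] at ht ⊢
          revert ht
          cases g u w <;> cases g w z <;> cases g z u <;> simp
    · have : Nontrivial V := Fintype.one_lt_card_iff_nontrivial.1 (by omega)
      obtain ⟨w, h⟩ := hG.preconnected.exists_adj_of_nontrivial u
      refine ⟨2, by simp, dPath_gainDigraph_cons hs g h (.cons h.symm .nil) i j ?_⟩
      simpa [walkGain, hg _ _ h, ← Bool.not_eq] using hc
  · obtain ⟨p, hp⟩ := (hG.preconnected u v).exists_walk_length_eq_edist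
    have hle : (p.length : ℕ∞) ≤ G.ediam := hp.le.trans G.edist_le_ediam
    cases p with
    | nil => exact absurd rfl huv
    | @cons _ w _ h p =>
      by_cases hc : copyClass (⟨v, j⟩ : Σ v : V, Fin (s v)) =
          xor (copyClass (⟨u, i⟩ : Σ v : V, Fin (s v))) (walkGain g (.cons h p))
      · exact ⟨p.length + 1, hle.trans le_self_add, dPath_gainDigraph_cons hs g h p i j hc⟩
      · refine ⟨p.length + 1 + 2, ?_,
          dPath_gainDigraph_cons hs g h (.cons h.symm (.cons h p)) i j ?_⟩
        · rw [Nat.cast_add]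
          exact add_le_add_left hle 2
        · simp only [walkGain, hg _ _ h] at hc ⊢
          revert hc
          generalize copyClass (⟨v, j⟩ : Σ v : V, Fin (s v)) = a
          generalize copyClass (⟨u, i⟩ : Σ v : V, Fin (s v)) = b
          cases a <;> cases b <;> cases g u w <;> cases walkGain g p <;> simp

theorem orientNum_vertexMult_le [Fintype V] {G : SimpleGraph V} (hG : G.Connected)
    (hn : 3 ≤ Fintype.card V) {s : V → ℕ} (hs : ∀ v, 2 ≤ s v) :
    orientNum (vertexMult G s) ≤ G.ediam + 2 := by
  let f := Fintype.equivFin V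
  have hg : ∀ u v, G.Adj u v → decide (f u < f v) = !decide (f v < f u) := by
    intro u v h
    have hne : f u ≠ f v := f.injective.ne h.ne
    rcases lt_or_gt_of_ne hne with hlt | hlt <;> simp [hlt, hlt.le]
  have key := exists_dPath_gainDigraph_le hG hn hs (g := fun u v => decide (f v < f u)) hg
  have hstrong : IsStrongOrientation (vertexMult G s)
      (gainDigraph G s fun u v => decide (f v < f u)) :=
    ⟨isOrientation_gainDigraph s hg, fun x y => (key x y).imp fun _ h => h.2⟩
  calc orientNum (vertexMult G s)
      ≤ odiam (gainDigraph G s fun u v => decide (f v < f u)) := sInf_le ⟨_, hstrong, rfl⟩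
    _ ≤ G.ediam + 2 := iSup₂_le fun x y => by
      obtain ⟨m, hle, hm⟩ := key x y
      exact (ddist_le_of_dPath hm).trans hle

theorem stmt1 [Fintype V] (G : SimpleGraph V) (hG : G.Connected)
    (hn : 3 ≤ Fintype.card V) (s : V → ℕ) (hs : ∀ v, 2 ≤ s v) :
    G.ediam ≤ orientNum (vertexMult G s) ∧ orientNum (vertexMult G s) ≤ G.ediam + 2 :=
  ⟨ediam_le_orientNum_vertexMult G fun v => zero_lt_two.trans_le (hs v),
    orientNum_vertexMult_le hG hn hs⟩
end

section
/- Let G be a connected simple graph with vertex set {v_1, ..., v_n}, and let μ_1, ..., μ_n and λ_1, ..., λ_n be positive integers with μ_i ≤ λ_i for all i. Suppose the vertex-multiplication G(μ_1, ..., μ_n) admits an orientation F of finite diameter d(F) in which every vertex lies on a directed cycle of length not exceeding m. Then G(λ_1, ..., λ_n) admits a strong orientation of diameter at most max{m, d(F)}. -/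
open SimpleGraph

variable {V : Type*}

theorem DPath.comap {A B : Type*} {F : B → B → Prop} {p : A → B} (hp : Function.Surjective p)
    {n : ℕ} {x y : A} (h : DPath F (n + 1) (p x) (p y)) :
    DPath (fun a b => F (p a) (p b)) (n + 1) x y := by
  induction n generalizing x with
  | zero =>
    obtain ⟨w, hw, rfl⟩ := h
    exact ⟨y, hw, rfl⟩
  | succ n ih =>
    obtain ⟨w, hw, hwy⟩ := h
    obtain ⟨a, rfl⟩ := hp w
    exact ⟨a, hw, ih hwy⟩

theorem ddist_le_of_dPath_s2 {A : Type*} {D : A → A → Prop} {n : ℕ} {u v : A} (h : DPath D n u v) :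
    ddist D u v ≤ n :=
  sInf_le ⟨n, rfl, h⟩

theorem exists_dPath_le_odiam {A : Type*} {D : A → A → Prop} (hD : odiam D ≠ ⊤) (u v : A) :
    ∃ n : ℕ, (n : ℕ∞) ≤ odiam D ∧ DPath D n u v := by
  have hle : ddist D u v ≤ odiam D := le_iSup_of_le u (le_iSup_of_le v le_rfl)
  have hne : {n : ℕ∞ | ∃ m : ℕ, n = (m : ℕ∞) ∧ DPath D m u v}.Nonempty := by
    by_contra h
    rw [Set.not_nonempty_iff_eq_empty] at h
    rw [ddist, h, sInf_empty, top_le_iff] at hle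
    exact hD hle
  obtain ⟨n, hn, hpath⟩ := csInf_mem hne
  exact ⟨n, hn ▸ hle, hpath⟩

/-- Pulling a digraph of finite diameter back along a surjection (so that each vertex is replaced
by twins) increases distances at most up to the length of a closed walk through a vertex. -/
theorem exists_dPath_comap_le {A B : Type*} {F : B → B → Prop} {p : A → B}
    (hp : Function.Surjective p) {m : ℕ} (hF : odiam F ≠ ⊤)
    (hcyc : ∀ x, ∃ k : ℕ, 1 ≤ k ∧ k ≤ m ∧ DPath F k x x) (x y : A) :
    ∃ n : ℕ, (n : ℕ∞) ≤ max (m : ℕ∞) (odiam F) ∧ DPath (fun a b => F (p a) (p b)) n x y := by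
  by_cases hxy : p x = p y
  · obtain ⟨k, hk, hkm, hpath⟩ := hcyc (p x)
    obtain ⟨k, rfl⟩ := Nat.exists_eq_add_of_le' hk
    refine ⟨k + 1, le_max_of_le_left (by exact_mod_cast hkm), DPath.comap hp ?_⟩
    rwa [← hxy]
  · obtain ⟨n, hn, hpath⟩ := exists_dPath_le_odiam hF (p x) (p y)
    cases n with
    | zero => exact absurd hpath hxy
    | succ n => exact ⟨n + 1, le_max_of_le_right hn, hpath.comap hp⟩

theorem stmt2 (G : SimpleGraph V) (hG : G.Connected) (μ lam : V → ℕ)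
    (hμ : ∀ v, 1 ≤ μ v) (hle : ∀ v, μ v ≤ lam v) (m : ℕ)
    (F : (Σ v : V, Fin (μ v)) → (Σ v : V, Fin (μ v)) → Prop)
    (hF : IsOrientation (vertexMult G μ) F) (hFfin : odiam F ≠ ⊤)
    (hcyc : ∀ x : Σ v : V, Fin (μ v), ∃ k : ℕ, 1 ≤ k ∧ k ≤ m ∧ DPath F k x x) :
    ∃ D : (Σ v : V, Fin (lam v)) → (Σ v : V, Fin (lam v)) → Prop,
      IsStrongOrientation (vertexMult G lam) D ∧ odiam D ≤ max (m : ℕ∞) (odiam F) := by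
  let p : (Σ v : V, Fin (lam v)) → (Σ v : V, Fin (μ v)) := fun x =>
    ⟨x.1, ⟨min x.2 (μ x.1 - 1), by have := hμ x.1; omega⟩⟩
  have hp : Function.Surjective p := by
    rintro ⟨v, i⟩
    refine ⟨⟨v, Fin.castLE (hle v) i⟩, Sigma.ext rfl (heq_of_eq (Fin.ext ?_))⟩
    change min (i : ℕ) (μ v - 1) = i
    omega
  have hpath := exists_dPath_comap_le hp hFfin hcyc
  refine ⟨fun x y => F (p x) (p y),
    ⟨⟨fun u v h => hF.1 _ _ h, fun u v h => hF.2 (p u) (p v) h⟩, fun u v => ?_⟩,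
    iSup_le fun u => iSup_le fun v => ?_⟩
  · obtain ⟨n, -, h⟩ := hpath u v
    exact ⟨n, h⟩
  · obtain ⟨n, hn, h⟩ := hpath u v
    exact (ddist_le_of_dPath_s2 h).trans hn
end

section
/- Let T be a tree of diameter 5 with central vertices v_1 and v_2 (the two adjacent vertices of eccentricity 3). Let A = {x ∈ V(T) : there exist distinct vertices u, v ∈ V(T) with d_T(x, u) = 5 and d_T(x, v) = 5}. If deg_T(v) ≤ 2 for every vertex v ∉ {v_1, v_2} and |A| ≥ 2, then d̄(T^(2)) = 6; that is, T^(2) belongs to class C_1, where T^(2) denotes the vertex-multiplication of T in which every vertex is assigned multiplicity 2. -/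
open SimpleGraph

variable {V : Type*}

/-! ### Layerings -/

/-- A layering of `T` along the edge `v₁v₂`: the vertices `v₁`, `v₂` form the layers `2` and `3`,
the layers `1` and `4` are neighbours of `v₁` and `v₂`, each of which has at most one further
neighbour, lying in the layer `0` or `5` respectively. -/
structure IsLayering (T : SimpleGraph V) (v₁ v₂ : V) (h : V → ℕ) : Prop where
  le_five : ∀ u, h u ≤ 5
  step : ∀ {u w}, T.Adj u w → h u = h w + 1 ∨ h w = h u + 1
  center : T.Adj v₁ v₂
  left : h v₁ = 2
  right : h v₂ = 3
  eq_left : ∀ {u}, h u = 2 → u = v₁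
  eq_right : ∀ {u}, h u = 3 → u = v₂
  adj_left : ∀ {u}, h u = 1 → T.Adj u v₁
  adj_right : ∀ {u}, h u = 4 → T.Adj u v₂
  exists_adj_left : ∀ {u}, h u = 0 → ∃ a, T.Adj u a
  exists_adj_right : ∀ {u}, h u = 5 → ∃ a, T.Adj u a
  parent_left : ∀ {u a b}, h u = 0 → T.Adj u a → T.Adj u b → a = b
  parent_right : ∀ {u a b}, h u = 5 → T.Adj u a → T.Adj u b → a = b
  child_left : ∀ {a x y}, h x = 0 → h y = 0 → T.Adj a x → T.Adj a y → x = y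
  child_right : ∀ {a x y}, h x = 5 → h y = 5 → T.Adj a x → T.Adj a y → x = y

/-- Reversing the layers exchanges the roles of `v₁` and `v₂`. -/
theorem IsLayering.reverse {T : SimpleGraph V} {v₁ v₂ : V} {h : V → ℕ}
    (L : IsLayering T v₁ v₂ h) : IsLayering T v₂ v₁ (fun u => 5 - h u) where
  le_five u := by omega
  step {u w} e := by
    have := L.step e; have := L.le_five u; have := L.le_five w; omega
  center := L.center.symm
  left := by simp [L.right]
  right := by simp [L.left]
  eq_left {u} e := L.eq_right (by have := L.le_five u; omega)
  eq_right {u} e := L.eq_left (by have := L.le_five u; omega)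
  adj_left {u} e := L.adj_right (by have := L.le_five u; omega)
  adj_right {u} e := L.adj_left (by have := L.le_five u; omega)
  exists_adj_left {u} e := L.exists_adj_right (by have := L.le_five u; omega)
  exists_adj_right {u} e := L.exists_adj_left (by have := L.le_five u; omega)
  parent_left {u a b} e := L.parent_right (by have := L.le_five u; omega)
  parent_right {u a b} e := L.parent_left (by have := L.le_five u; omega)
  child_left {a x y} e f := L.child_right (by have := L.le_five x; omega)
    (by have := L.le_five y; omega)
  child_right {a x y} e f := L.child_left (by have := L.le_five x; omega)
    (by have := L.le_five y; omega)

/-! ### Directed walks and distances -/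

/-- `w` is reachable from `u` by a directed walk of length at most `n`. -/
def ReachIn (D : V → V → Prop) (n : ℕ) (u w : V) : Prop := ∃ m ≤ n, DPath D m u w

theorem ReachIn.refl {D : V → V → Prop} (n : ℕ) (u : V) : ReachIn D n u u :=
  ⟨0, Nat.zero_le _, rfl⟩

theorem ReachIn.mono {D : V → V → Prop} {n m : ℕ} {u w : V} (r : ReachIn D n u w) (k : n ≤ m) :
    ReachIn D m u w := by
  obtain ⟨l, hl, p⟩ := r
  exact ⟨l, hl.trans k, p⟩

theorem ReachIn.cons {D : V → V → Prop} {n : ℕ} {u v w : V} (a : D u v) (r : ReachIn D n v w) :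
    ReachIn D (n + 1) u w := by
  obtain ⟨l, hl, p⟩ := r
  exact ⟨l + 1, by omega, v, a, p⟩

theorem DPath.trans {D : V → V → Prop} {n m : ℕ} {u v w : V} (p : DPath D n u v)
    (q : DPath D m v w) : DPath D (n + m) u w := by
  induction n generalizing u with
  | zero => cases p; simpa using q
  | succ n ih =>
    obtain ⟨z, a, p⟩ := p
    rw [Nat.add_right_comm]
    exact ⟨z, a, ih p⟩

theorem DPath.flip {D : V → V → Prop} {n : ℕ} {u v : V} (p : DPath D n u v) :
    DPath (flip D) n v u := by
  induction n generalizing u with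
  | zero => exact Eq.symm p
  | succ n ih =>
    obtain ⟨z, a, p⟩ := p
    exact (ih p).trans (m := 1) ⟨u, a, rfl⟩

theorem ReachIn.ddist_le {D : V → V → Prop} {n : ℕ} {u w : V} (r : ReachIn D n u w) :
    ddist D u w ≤ n := by
  obtain ⟨m, hm, p⟩ := r
  have : ddist D u w ≤ m := sInf_le ⟨m, rfl, p⟩
  exact this.trans (by exact_mod_cast hm)

theorem reachIn_of_odiam_lt {D : V → V → Prop} {n : ℕ} (hD : odiam D < (n + 1 : ℕ)) (u w : V) :
    ReachIn D n u w := by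
  have : ddist D u w < (n + 1 : ℕ) :=
    (le_iSup_of_le u (le_iSup (fun w => ddist D u w) w)).trans_lt hD
  obtain ⟨_, ⟨m, rfl, p⟩, hm⟩ := sInf_lt_iff.1 this
  exact ⟨m, Nat.lt_succ_iff.1 (by exact_mod_cast hm), p⟩

/-! ### The lower bound -/

/-- An orientation of the vertex-multiplication by `2` all of whose distances are at most `5`. -/
def IsTight (T : SimpleGraph V) (D : (Σ _ : V, Fin 2) → (Σ _ : V, Fin 2) → Prop) : Prop :=
  IsOrientation (vertexMult T (fun _ : V => 2)) D ∧ ∀ u w, ReachIn D 5 u w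

namespace IsTight

variable {T : SimpleGraph V} {v₁ v₂ : V} {h : V → ℕ}
  {D : (Σ _ : V, Fin 2) → (Σ _ : V, Fin 2) → Prop}

theorem reverse (P : IsTight T D) : IsTight T (flip D) := by
  refine ⟨⟨fun u v a => (P.1.1 v u a).symm, fun u v a => P.1.2 v u a.symm⟩, fun u w => ?_⟩
  obtain ⟨m, hm, p⟩ := P.2 w u
  exact ⟨m, hm, p.flip⟩

theorem adj (P : IsTight T D) {u w : Σ _ : V, Fin 2} (a : D u w) : T.Adj u.1 w.1 :=
  P.1.1 u w a

theorem asymm (P : IsTight T D) {u w : Σ _ : V, Fin 2} (a : D u w) (b : D w u) : False :=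
  (P.1.2 u w (P.1.1 u w a)).1 a b

theorem layer_bounds (L : IsLayering T v₁ v₂ h) (P : IsTight T D) {m : ℕ}
    {u w : Σ _ : V, Fin 2} (p : DPath D m u w) :
    h w.1 ≤ h u.1 + m ∧ h u.1 ≤ h w.1 + m ∧ (h u.1 + h w.1 + m) % 2 = 0 := by
  induction m generalizing u with
  | zero => cases p; omega
  | succ m ih =>
    obtain ⟨z, a, p⟩ := p
    have := ih p
    have := L.step (P.adj a)
    omega

/-- Directed walks climbing four layers within distance `5` are monotone. -/
theorem exists_climb (L : IsLayering T v₁ v₂ h) (P : IsTight T D) {u w : Σ _ : V, Fin 2}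
    (e : h w.1 = h u.1 + 4) : ∃ z₁ z₂ z₃, D u z₁ ∧ D z₁ z₂ ∧ D z₂ z₃ ∧ D z₃ w ∧
      h z₁.1 = h u.1 + 1 ∧ h z₂.1 = h u.1 + 2 ∧ h z₃.1 = h u.1 + 3 := by
  obtain ⟨m, hm, p⟩ := P.2 u w
  have b := P.layer_bounds L p
  obtain rfl : m = 4 := by omega
  obtain ⟨z₁, a₁, z₂, a₂, z₃, a₃, z₄, a₄, rfl⟩ := p
  have := L.step (P.adj a₁)
  have := L.step (P.adj a₂)
  have := L.step (P.adj a₃)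
  have := L.step (P.adj a₄)
  exact ⟨z₁, z₂, z₃, a₁, a₂, a₃, a₄, by omega, by omega, by omega⟩

theorem exists_out (L : IsLayering T v₁ v₂ h) (P : IsTight T D) {y : V} (hy : h y = 5)
    {a : Σ _ : V, Fin 2} (ha : h a.1 = 1) : ∃ e, D a ⟨v₁, e⟩ := by
  obtain ⟨⟨z, e⟩, -, -, a₁, -, -, -, hz, -⟩ := P.exists_climb L (u := a) (w := ⟨y, 0⟩) (by simp; omega)
  obtain rfl := L.eq_left (u := z) (by simp at hz; omega)
  exact ⟨e, a₁⟩

theorem exists_in (L : IsLayering T v₁ v₂ h) (P : IsTight T D) {y : V} (hy : h y = 5)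
    {a : Σ _ : V, Fin 2} (ha : h a.1 = 1) : ∃ e, D ⟨v₁, e⟩ a :=
  P.reverse.exists_out L hy ha

/-- Walks between distinct branches on the left pass through a copy of `v₁`. -/
theorem exists_crossing (L : IsLayering T v₁ v₂ h) (P : IsTight T D) {x x' : V} (hx : h x = 0)
    (hx' : h x' = 0) (ne : x ≠ x') : ∃ a b e, h a.1 = 1 ∧ h b.1 = 1 ∧
      D a ⟨v₁, e⟩ ∧ D ⟨v₁, e⟩ b := by
  obtain ⟨m, hm, p⟩ := P.2 ⟨x, 0⟩ ⟨x', 0⟩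
  have b := P.layer_bounds L p
  simp only [hx, hx'] at b
  have nobridge : ∀ z : V, T.Adj x z → T.Adj z x' → False := fun z c d =>
    ne (L.child_left hx hx' c.symm d)
  obtain rfl | rfl | rfl : m = 0 ∨ m = 2 ∨ m = 4 := by omega
  · exact absurd (congrArg Sigma.fst p) ne
  · obtain ⟨z₁, a₁, z₂, a₂, rfl⟩ := p
    exact (nobridge _ (P.adj a₁) (P.adj a₂)).elim
  · obtain ⟨z₁, a₁, ⟨z₂, e⟩, a₂, z₃, a₃, z₄, a₄, rfl⟩ := p
    have b₁ := P.adj a₁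
    have b₂ := P.adj a₂
    have b₃ := P.adj a₃
    have b₄ := P.adj a₄
    have c₁ := L.step b₁
    have c₂ := L.step b₂
    have c₄ := L.step b₄
    simp only at b₁ b₂ b₃ b₄ c₁ c₂ c₄
    by_cases hz : h z₂ = 0
    · have := L.parent_left hz b₂.symm b₃
      exact (nobridge z₁.1 b₁ (this ▸ b₄)).elim
    · obtain rfl := L.eq_left (u := z₂) (by omega)
      exact ⟨z₁, z₃, e, by omega, by omega, a₂, a₃⟩

theorem eq_of_ne {a b c : Fin 2} (h : a ≠ c) (k : b ≠ c) : a = b := by omega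

/-- Each copy of `v₁` is the only copy of `v₁` dominating some vertex of layer `1`. -/
theorem exists_dominated (L : IsLayering T v₁ v₂ h) (P : IsTight T D) {x x' y : V} (hx : h x = 0)
    (hx' : h x' = 0) (ne : x ≠ x') (hy : h y = 5) (e : Fin 2) :
    ∃ a, h a.1 = 1 ∧ D ⟨v₁, e⟩ a ∧ ∀ e', D ⟨v₁, e'⟩ a → e' = e := by
  have key : ∃ a, h a.1 = 1 ∧ D ⟨v₁, e⟩ a := by
    obtain ⟨a, b, f, ha, hb, c, d⟩ := P.exists_crossing L hx hx' ne
    by_cases hf : f = e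
    · exact ⟨b, hb, hf ▸ d⟩
    · obtain ⟨g, hg⟩ := P.exists_in L hy ha
      have : g ≠ f := by rintro rfl; exact P.asymm c hg
      obtain rfl := eq_of_ne this (Ne.symm hf)
      exact ⟨a, ha, hg⟩
  obtain ⟨a, ha, d⟩ := key
  refine ⟨a, ha, d, fun e' d' => ?_⟩
  obtain ⟨g, hg⟩ := P.exists_out L hy ha
  exact eq_of_ne (c := g) (by rintro rfl; exact P.asymm d' hg) (by rintro rfl; exact P.asymm d hg)

/-- Some copy of `v₁` dominates both copies of `v₂`. -/
theorem exists_dominating (L : IsLayering T v₁ v₂ h) (P : IsTight T D) {x y y' : V} (hx : h x = 0)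
    (hy : h y = 5) (hy' : h y' = 5) (ne : y ≠ y') : ∃ e, ∀ f, D ⟨v₁, e⟩ ⟨v₂, f⟩ := by
  obtain ⟨a, hxa⟩ := L.exists_adj_left hx
  have ha : h a = 1 := by have := L.step hxa; omega
  obtain ⟨b, hyb⟩ := L.exists_adj_right hy
  have hb : h b = 4 := by have := L.step hyb; have := L.le_five b; omega
  obtain ⟨⟨z, s⟩, -, -, hs, -⟩ := P.reverse.exists_climb L (u := ⟨x, 0⟩) (w := ⟨b, 0⟩)
    (by simp [hx, hb])
  obtain rfl := L.parent_left hx hxa (P.reverse.adj hs)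
  obtain ⟨e₀, he₀⟩ := P.exists_in L hy (a := ⟨a, 1 - s⟩) ha
  refine ⟨1 - e₀, fun f => ?_⟩
  obtain ⟨c, hc, hfc, uniq⟩ := P.exists_dominated L.reverse (x := y) (x' := y') (y := x)
    (by omega) (by omega) ne (by omega) f
  have hc' : h c.1 = 4 := by have := L.le_five c.1; omega
  obtain ⟨⟨z₁, t⟩, ⟨z₂, e⟩, ⟨z₃, g⟩, a₁, a₂, a₃, a₄, -, h₂, h₃⟩ :=
    P.exists_climb L (u := ⟨x, 0⟩) (w := c) (by simp [hx, hc'])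
  obtain rfl := L.parent_left hx hxa (P.adj a₁)
  obtain rfl := L.eq_left (u := z₂) (by simpa [hx] using h₂)
  obtain rfl := L.eq_right (u := z₃) (by simpa [hx] using h₃)
  have ht : t ≠ s := by rintro rfl; exact P.asymm a₁ hs
  obtain rfl : t = 1 - s := by omega
  have he : e ≠ e₀ := by rintro rfl; exact P.asymm a₂ he₀
  obtain rfl : e = 1 - e₀ := by omega
  exact uniq g a₄ ▸ a₃

end IsTight

/-- Every orientation has diameter at least `6`. -/
theorem IsLayering.six_le_odiam {T : SimpleGraph V} {v₁ v₂ : V} {h : V → ℕ}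
    (L : IsLayering T v₁ v₂ h) {x x' y y' : V} (hx : h x = 0) (hx' : h x' = 0) (nex : x ≠ x')
    (hy : h y = 5) (hy' : h y' = 5) (ney : y ≠ y') {D : (Σ _ : V, Fin 2) → (Σ _ : V, Fin 2) → Prop}
    (hD : IsOrientation (vertexMult T (fun _ : V => 2)) D) : 6 ≤ odiam D := by
  by_contra! lt
  have P : IsTight T D := ⟨hD, reachIn_of_odiam_lt (n := 5) lt⟩
  obtain ⟨e, he⟩ := P.exists_dominating L hx hy hy' ney
  obtain ⟨f, hf⟩ := P.exists_dominating L.reverse (x := y) (y := x) (y' := x') (by omega)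
    (by omega) (by omega) nex
  exact P.asymm (he f) (hf e)

/-! ### The upper bound -/

/-- `z` is the first copy of a vertex having a neighbour in an extreme layer. -/
def IsSource (T : SimpleGraph V) (h : V → ℕ) (z : Σ _ : V, Fin 2) : Prop :=
  z.2 = 0 ∧ ∃ x, T.Adj z.1 x ∧ (h x = 0 ∨ h x = 5)

/-- An orientation of the vertex-multiplication by `2` of diameter at most `6`. -/
def layerOrientation (T : SimpleGraph V) (h : V → ℕ) (u w : Σ _ : V, Fin 2) : Prop :=
  T.Adj u.1 w.1 ∧
    (h u.1 = 0 ∧ h w.1 = 1 ∧ IsSource T h w ∨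
     h u.1 = 1 ∧ h w.1 = 0 ∧ ¬ IsSource T h u ∨
     h u.1 = 1 ∧ h w.1 = 2 ∧ (IsSource T h u ∨ w.2 = 0) ∨
     h u.1 = 2 ∧ h w.1 = 1 ∧ ¬ IsSource T h w ∧ u.2 = 1 ∨
     h u.1 = 2 ∧ h w.1 = 3 ∧ u.2 = 0 ∧ w.2 = 1 ∨
     h u.1 = 3 ∧ h w.1 = 2 ∧ (u.2 = 0 ∨ w.2 = 1) ∨
     h u.1 = 5 ∧ h w.1 = 4 ∧ IsSource T h w ∨
     h u.1 = 4 ∧ h w.1 = 5 ∧ ¬ IsSource T h u ∨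
     h u.1 = 4 ∧ h w.1 = 3 ∧ (IsSource T h u ∨ w.2 = 0) ∨
     h u.1 = 3 ∧ h w.1 = 4 ∧ ¬ IsSource T h w ∧ u.2 = 1)

namespace IsLayering

variable {T : SimpleGraph V} {v₁ v₂ : V} {h : V → ℕ}

theorem isOrientation (L : IsLayering T v₁ v₂ h) :
    IsOrientation (vertexMult T (fun _ : V => 2)) (layerOrientation T h) := by
  refine ⟨fun u w a => a.1, fun u w (a : T.Adj u.1 w.1) => ?_⟩
  have step := L.step a
  have hu := L.le_five u.1
  have hw := L.le_five w.1
  have two : ∀ i : Fin 2, i = 1 ↔ ¬ i = 0 := by decide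
  simp only [layerOrientation, a, a.symm, true_and, two]
  generalize h u.1 = i at *
  generalize h w.1 = j at *
  interval_cases i <;> interval_cases j <;> simp at step ⊢ <;> tauto

variable {z : Σ _ : V, Fin 2}

theorem arc_center (L : IsLayering T v₁ v₂ h) : layerOrientation T h ⟨v₁, 0⟩ ⟨v₂, 1⟩ :=
  ⟨L.center, by simp [L.left, L.right]⟩

theorem arc_center_symm (L : IsLayering T v₁ v₂ h) {i j : Fin 2} (e : i = 0 ∨ j = 1) :
    layerOrientation T h ⟨v₂, i⟩ ⟨v₁, j⟩ :=
  ⟨L.center.symm, by simp [L.left, L.right, e]⟩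

theorem arc_left (L : IsLayering T v₁ v₂ h) (hz : h z.1 = 1) : layerOrientation T h z ⟨v₁, 0⟩ :=
  ⟨L.adj_left hz, by simp [L.left, hz]⟩

theorem arc_right (L : IsLayering T v₁ v₂ h) (hz : h z.1 = 4) : layerOrientation T h z ⟨v₂, 0⟩ :=
  ⟨L.adj_right hz, by simp [L.right, hz]⟩

theorem arc_left_of_isSource (L : IsLayering T v₁ v₂ h) (hz : h z.1 = 1) (s : IsSource T h z)
    (i : Fin 2) : layerOrientation T h z ⟨v₁, i⟩ :=
  ⟨L.adj_left hz, by simp [L.left, hz, s]⟩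

theorem arc_right_of_isSource (L : IsLayering T v₁ v₂ h) (hz : h z.1 = 4) (s : IsSource T h z)
    (i : Fin 2) : layerOrientation T h z ⟨v₂, i⟩ :=
  ⟨L.adj_right hz, by simp [L.right, hz, s]⟩

theorem arc_to_left (L : IsLayering T v₁ v₂ h) (hz : h z.1 = 1) (s : ¬ IsSource T h z) :
    layerOrientation T h ⟨v₁, 1⟩ z :=
  ⟨(L.adj_left hz).symm, by simp [L.left, hz, s]⟩

theorem arc_to_right (L : IsLayering T v₁ v₂ h) (hz : h z.1 = 4) (s : ¬ IsSource T h z) :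
    layerOrientation T h ⟨v₂, 1⟩ z :=
  ⟨(L.adj_right hz).symm, by simp [L.right, hz, s]⟩

/-- Each vertex of layer `0` lies on an arc from a non-source and on an arc to a source. -/
theorem exists_arcs_left (L : IsLayering T v₁ v₂ h) {x a : V} (hx : h x = 0) (e : T.Adj x a)
    (i : Fin 2) : h a = 1 ∧ IsSource T h ⟨a, 0⟩ ∧ ¬ IsSource T h ⟨a, 1⟩ ∧
      layerOrientation T h ⟨x, i⟩ ⟨a, 0⟩ ∧ layerOrientation T h ⟨a, 1⟩ ⟨x, i⟩ := by
  have ha : h a = 1 := by have := L.step e; omega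
  have s : IsSource T h ⟨a, 0⟩ := ⟨rfl, x, e.symm, .inl hx⟩
  have s' : ¬ IsSource T h ⟨a, 1⟩ := fun k => absurd k.1 (by simp)
  exact ⟨ha, s, s', ⟨e, by simp [hx, ha, s]⟩, ⟨e.symm, by simp [hx, ha, s']⟩⟩

theorem exists_arcs_right (L : IsLayering T v₁ v₂ h) {x a : V} (hx : h x = 5) (e : T.Adj x a)
    (i : Fin 2) : h a = 4 ∧ IsSource T h ⟨a, 0⟩ ∧ ¬ IsSource T h ⟨a, 1⟩ ∧
      layerOrientation T h ⟨x, i⟩ ⟨a, 0⟩ ∧ layerOrientation T h ⟨a, 1⟩ ⟨x, i⟩ := by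
  have ha : h a = 4 := by have := L.step e; have := L.le_five a; omega
  have s : IsSource T h ⟨a, 0⟩ := ⟨rfl, x, e.symm, .inr hx⟩
  have s' : ¬ IsSource T h ⟨a, 1⟩ := fun k => absurd k.1 (by simp)
  exact ⟨ha, s, s', ⟨e, by simp [hx, ha, s]⟩, ⟨e.symm, by simp [hx, ha, s']⟩⟩

theorem reachIn_left (L : IsLayering T v₁ v₂ h) (hz : h z.1 ≤ 1) :
    ReachIn (layerOrientation T h) 3 ⟨v₁, 1⟩ z := by
  obtain hz | hz : h z.1 = 0 ∨ h z.1 = 1 := by omega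
  · obtain ⟨a, e⟩ := L.exists_adj_left hz
    obtain ⟨ha, -, s, -, k⟩ := L.exists_arcs_left hz e z.2
    exact .cons (L.arc_to_left (z := ⟨a, 1⟩) ha s) (.cons k (.refl _ _))
  · by_cases s : IsSource T h z
    · obtain ⟨a, i⟩ := z
      obtain ⟨rfl : i = 0, x, e, hx⟩ := id s
      obtain hx : h x = 0 := by have := L.step e; simp only at *; omega
      obtain ⟨ha, -, s', k, k'⟩ := L.exists_arcs_left hx e.symm 0
      exact .cons (L.arc_to_left (z := ⟨a, 1⟩) ha s') (.cons k' (.cons k (.refl _ _)))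
    · exact .cons (L.arc_to_left hz s) (.refl _ _)

theorem reachIn_right (L : IsLayering T v₁ v₂ h) (hz : 4 ≤ h z.1) :
    ReachIn (layerOrientation T h) 3 ⟨v₂, 1⟩ z := by
  have := L.le_five z.1
  obtain hz | hz : h z.1 = 5 ∨ h z.1 = 4 := by omega
  · obtain ⟨a, e⟩ := L.exists_adj_right hz
    obtain ⟨ha, -, s, -, k⟩ := L.exists_arcs_right hz e z.2
    exact .cons (L.arc_to_right (z := ⟨a, 1⟩) ha s) (.cons k (.refl _ _))
  · by_cases s : IsSource T h z
    · obtain ⟨a, i⟩ := z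
      obtain ⟨rfl : i = 0, x, e, hx⟩ := id s
      obtain hx : h x = 5 := by have := L.step e; simp only at *; omega
      obtain ⟨ha, -, s', k, k'⟩ := L.exists_arcs_right hx e.symm 0
      exact .cons (L.arc_to_right (z := ⟨a, 1⟩) ha s') (.cons k' (.cons k (.refl _ _)))
    · exact .cons (L.arc_to_right hz s) (.refl _ _)

theorem left_or_center_or_right (L : IsLayering T v₁ v₂ h) (z : Σ _ : V, Fin 2) :
    h z.1 ≤ 1 ∨ 4 ≤ h z.1 ∨ z = ⟨v₁, 0⟩ ∨ z = ⟨v₁, 1⟩ ∨ z = ⟨v₂, 0⟩ ∨ z = ⟨v₂, 1⟩ := by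
  obtain ⟨a, i⟩ := z
  obtain k | k | k | k : h a ≤ 1 ∨ 4 ≤ h a ∨ h a = 2 ∨ h a = 3 := by omega
  · exact .inl k
  · exact .inr (.inl k)
  · obtain rfl := L.eq_left k
    fin_cases i <;> simp
  · obtain rfl := L.eq_right k
    fin_cases i <;> simp

/-- All distances in `layerOrientation` are at most `6`. -/
theorem reachIn_six (L : IsLayering T v₁ v₂ h) {x y : V} (hx : h x = 0) (hy : h y = 5)
    (u z : Σ _ : V, Fin 2) : ReachIn (layerOrientation T h) 6 u z := by
  have p₁p₀ : ReachIn (layerOrientation T h) 2 ⟨v₁, 1⟩ ⟨v₁, 0⟩ := by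
    obtain ⟨a, e⟩ := L.exists_adj_left hx
    obtain ⟨ha, -, s, -⟩ := L.exists_arcs_left hx e 0
    exact .cons (L.arc_to_left (z := ⟨a, 1⟩) ha s) (.cons (L.arc_left ha) (.refl _ _))
  have q₁q₀ : ReachIn (layerOrientation T h) 2 ⟨v₂, 1⟩ ⟨v₂, 0⟩ := by
    obtain ⟨a, e⟩ := L.exists_adj_right hy
    obtain ⟨ha, -, s, -⟩ := L.exists_arcs_right hy e 0
    exact .cons (L.arc_to_right (z := ⟨a, 1⟩) ha s) (.cons (L.arc_right ha) (.refl _ _))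
  have q₁p₁ := L.arc_center_symm (i := 1) (j := 1) (.inr rfl)
  have q₀p₀ := L.arc_center_symm (i := 0) (j := 0) (.inl rfl)
  have q₀p₁ := L.arc_center_symm (i := 0) (j := 1) (.inl rfl)
  have p₀q₁ := L.arc_center
  have q₁ : ∀ z, ReachIn (layerOrientation T h) 4 ⟨v₂, 1⟩ z := fun z => by
    obtain k | k | rfl | rfl | rfl | rfl := L.left_or_center_or_right z
    · exact .cons q₁p₁ (L.reachIn_left k)
    · exact (L.reachIn_right k).mono (by norm_num)
    · exact (ReachIn.cons q₁p₁ p₁p₀).mono (by norm_num)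
    · exact .cons q₁p₁ (.refl _ _)
    · exact q₁q₀.mono (by norm_num)
    · exact .refl _ _
  have p₀ : ∀ z, ReachIn (layerOrientation T h) 5 ⟨v₁, 0⟩ z := fun z => .cons p₀q₁ (q₁ z)
  have q₀ : ∀ z, ReachIn (layerOrientation T h) 5 ⟨v₂, 0⟩ z := fun z => by
    obtain k | k | rfl | rfl | rfl | rfl := L.left_or_center_or_right z
    · exact (ReachIn.cons q₀p₁ (L.reachIn_left k)).mono (by norm_num)
    · exact .cons q₀p₀ (.cons p₀q₁ (L.reachIn_right k))
    · exact .cons q₀p₀ (.refl _ _)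
    · exact .cons q₀p₁ (.refl _ _)
    · exact .refl _ _
    · exact .cons q₀p₀ (.cons p₀q₁ (.refl _ _))
  have hu := L.le_five u.1
  obtain k | k | k | rfl | rfl | rfl | rfl : h u.1 = 0 ∨ h u.1 = 5 ∨ (h u.1 = 1 ∨ h u.1 = 4) ∨
      u = ⟨v₁, 0⟩ ∨ u = ⟨v₁, 1⟩ ∨ u = ⟨v₂, 0⟩ ∨ u = ⟨v₂, 1⟩ := by
    have := L.left_or_center_or_right u
    rcases this with k | k | k
    · omega
    · omega
    · exact .inr (.inr (.inr k))
  · obtain ⟨a, e⟩ := L.exists_adj_left k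
    obtain ⟨ha, s, -, k, -⟩ := L.exists_arcs_left k e u.2
    have r₀ {n} (r : ReachIn (layerOrientation T h) n ⟨v₁, 0⟩ z) :
        ReachIn (layerOrientation T h) (n + 2) u z :=
      .cons k (.cons (L.arc_left_of_isSource (z := ⟨a, 0⟩) ha s 0) r)
    have r₁ {n} (r : ReachIn (layerOrientation T h) n ⟨v₁, 1⟩ z) :
        ReachIn (layerOrientation T h) (n + 2) u z :=
      .cons k (.cons (L.arc_left_of_isSource (z := ⟨a, 0⟩) ha s 1) r)
    obtain k | k | rfl | rfl | rfl | rfl := L.left_or_center_or_right z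
    · exact (r₁ (L.reachIn_left k)).mono (by norm_num)
    · exact r₀ (.cons p₀q₁ (L.reachIn_right k))
    · exact r₀ (.refl 4 _)
    · exact r₁ (.refl 4 _)
    · exact (r₀ (.cons p₀q₁ q₁q₀)).mono (by norm_num)
    · exact r₀ (.cons p₀q₁ (.refl 3 _))
  · obtain ⟨a, e⟩ := L.exists_adj_right k
    obtain ⟨ha, s, -, k, -⟩ := L.exists_arcs_right k e u.2
    exact .cons k (.cons (L.arc_right_of_isSource (z := ⟨a, 0⟩) ha s 1) (q₁ z))
  · rcases k with k | k
    · exact .cons (L.arc_left k) (p₀ z)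
    · exact .cons (L.arc_right k) (q₀ z)
  · exact (p₀ z).mono (by norm_num)
  · obtain k | k | rfl | rfl | rfl | rfl := L.left_or_center_or_right z
    · exact (L.reachIn_left k).mono (by norm_num)
    · obtain ⟨m, hm, p⟩ := p₁p₀
      obtain ⟨n, hn, q⟩ := ReachIn.cons p₀q₁ (L.reachIn_right k)
      exact ⟨m + n, by omega, p.trans q⟩
    · exact p₁p₀.mono (by norm_num)
    · exact .refl _ _
    · obtain ⟨m, hm, p⟩ := p₁p₀
      obtain ⟨n, hn, q⟩ := ReachIn.cons p₀q₁ q₁q₀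
      exact ⟨m + n, by omega, p.trans q⟩
    · obtain ⟨m, hm, p⟩ := p₁p₀
      exact ⟨m + 1, by omega, p.trans (m := 1) ⟨_, p₀q₁, rfl⟩⟩
  · exact (q₀ z).mono (by norm_num)
  · exact (q₁ z).mono (by norm_num)

theorem orientNum_eq_six (L : IsLayering T v₁ v₂ h) {x x' y y' : V} (hx : h x = 0)
    (hx' : h x' = 0) (nex : x ≠ x') (hy : h y = 5) (hy' : h y' = 5) (ney : y ≠ y') :
    orientNum (vertexMult T (fun _ : V => 2)) = 6 := by
  apply le_antisymm
  · have r := L.reachIn_six hx hy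
    have mem : IsStrongOrientation (vertexMult T (fun _ : V => 2)) (layerOrientation T h) :=
      ⟨L.isOrientation, fun u w => (r u w).imp fun _ k => k.2⟩
    have le : orientNum (vertexMult T (fun _ : V => 2)) ≤ odiam (layerOrientation T h) :=
      sInf_le ⟨_, mem, rfl⟩
    exact le.trans (iSup_le fun u => iSup_le fun w => (r u w).ddist_le)
  · refine le_sInf ?_
    rintro _ ⟨D, hD, rfl⟩
    exact L.six_le_odiam hx hx' nex hy hy' ney hD.1

end IsLayering

/-! ### Trees of diameter five -/

theorem SimpleGraph.IsTree.parent_unique {T : SimpleGraph V} (hT : T.IsTree) {z u a b : V}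
    (ha : T.Adj a u) (hb : T.Adj b u) (da : T.dist z u = T.dist z a + 1)
    (db : T.dist z u = T.dist z b + 1) : a = b := by
  obtain ⟨p, hp⟩ := hT.connected.exists_walk_length_eq_dist z a
  obtain ⟨q, hq⟩ := hT.connected.exists_walk_length_eq_dist z b
  have hp' := (p.concat ha).isPath_of_length_eq_dist (by simp [hp, da])
  have hq' := (q.concat hb).isPath_of_length_eq_dist (by simp [hq, db])
  have := congrArg Walk.penultimate ((hT.existsUnique_path z u).unique hp' hq')
  simpa using this

theorem SimpleGraph.Connected.exists_parent {T : SimpleGraph V} (hT : T.Connected) {z u : V}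
    (h : T.dist z u ≠ 0) : ∃ a, T.Adj u a ∧ T.dist z u = T.dist z a + 1 := by
  obtain ⟨p, hp⟩ := hT.exists_walk_length_eq_dist u z
  rw [dist_comm] at hp
  cases p with
  | nil => exact (h (by simp)).elim
  | @cons _ a _ e q =>
    refine ⟨a, e, ?_⟩
    have h₁ := dist_le q
    have h₂ := hT.dist_triangle (u := z) (v := a) (w := u)
    rw [dist_eq_one_iff_adj.2 e.symm] at h₂
    rw [dist_comm] at h₁
    simp only [Walk.length_cons] at hp
    omega

/-- The layer of `u` determined by its distances to `v₁` and `v₂`. -/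
noncomputable def layer (T : SimpleGraph V) (v₁ v₂ u : V) : ℕ :=
  if T.dist v₁ u < T.dist v₂ u then 2 - T.dist v₁ u else 3 + T.dist v₂ u

section Tree

variable {T : SimpleGraph V} {v₁ v₂ : V}

theorem layer_spec (hT : T.IsTree) (hadj : T.Adj v₁ v₂) (hecc₁ : ecc T v₁ = 3)
    (hecc₂ : ecc T v₂ = 3) (u : V) :
    T.dist v₂ u = T.dist v₁ u + 1 ∧ T.dist v₁ u ≤ 2 ∧ layer T v₁ v₂ u + T.dist v₁ u = 2 ∨
    T.dist v₁ u = T.dist v₂ u + 1 ∧ T.dist v₂ u ≤ 2 ∧ layer T v₁ v₂ u = 3 + T.dist v₂ u := by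
  have bound : ∀ v, ecc T v = 3 → T.dist v u ≤ 3 := fun v hv => by
    have : T.edist v u ≤ 3 := hv ▸ le_iSup (fun u => T.edist v u) u
    rw [← (hT.connected v u).coe_dist_eq_edist] at this
    exact_mod_cast this
  have b₁ := bound v₁ hecc₁
  have b₂ := bound v₂ hecc₂
  have := hT.dist_eq_dist_add_one_of_adj u hadj
  rw [dist_comm, dist_comm (v := v₂)] at this
  unfold layer
  split_ifs <;> omega

theorem child_unique {c a x y : V} (hdeg : (T.neighborSet a).ncard ≤ 2)
    (hc : T.Adj a c) (hx : T.Adj a x) (hy : T.Adj a y) (hxc : x ≠ c) (hyc : y ≠ c)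
    (fin : (T.neighborSet a).Finite) : x = y := by
  by_contra ne
  have sub : {c, x, y} ⊆ T.neighborSet a := by
    rintro z (rfl | rfl | rfl) <;> assumption
  have := Set.ncard_le_ncard sub fin
  rw [Set.ncard_eq_three.2 ⟨c, x, y, hxc.symm, hyc.symm, ne, rfl⟩] at this
  omega

theorem isLayering_layer [Finite V] (hT : T.IsTree) (hadj : T.Adj v₁ v₂) (hecc₁ : ecc T v₁ = 3)
    (hecc₂ : ecc T v₂ = 3)
    (hdeg : ∀ v : V, v ≠ v₁ → v ≠ v₂ → (T.neighborSet v).ncard ≤ 2) :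
    IsLayering T v₁ v₂ (layer T v₁ v₂) := by
  have spec := layer_spec hT hadj hecc₁ hecc₂
  have d : ∀ z {u w}, T.Adj u w →
      T.dist z u = T.dist z w + 1 ∨ T.dist z w = T.dist z u + 1 :=
    fun z _ _ e => hT.dist_eq_dist_add_one_of_adj z e
  have zero : ∀ {z u}, T.dist z u = 0 → u = z := fun e =>
    (hT.connected.dist_eq_zero_iff.1 e).symm
  -- the only edge whose ends are closer to different central vertices is the central one
  have cross : ∀ {u w}, T.Adj u w → T.dist v₂ u = T.dist v₁ u + 1 →
      T.dist v₁ w = T.dist v₂ w + 1 → T.dist v₁ u = 0 ∧ T.dist v₂ w = 0 := by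
    intro u w e hu hw
    have e₁ := d v₁ e
    have e₂ := d v₂ e
    by_contra k
    obtain ⟨p, hp, dp⟩ := hT.connected.exists_parent (z := v₁) (u := u) (by omega)
    have sp := spec p
    have e₃ := d v₂ hp
    obtain rfl := hT.parent_unique (z := v₂) hp.symm e.symm (by omega) (by omega)
    omega
  have step : ∀ {u w}, T.Adj u w → layer T v₁ v₂ u = layer T v₁ v₂ w + 1 ∨
      layer T v₁ v₂ w = layer T v₁ v₂ u + 1 := by
    intro u w e
    have su := spec u
    have sw := spec w
    have e₁ := d v₁ e
    have e₂ := d v₂ e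
    have c := cross e
    have c' := cross e.symm
    omega
  have one : ∀ {z u}, T.dist z u = 1 → T.Adj u z := fun e => (dist_eq_one_iff_adj.1 e).symm
  have l₁ : layer T v₁ v₂ v₁ = 2 := by
    have := spec v₁; simp only [dist_self] at this; omega
  have l₂ : layer T v₁ v₂ v₂ = 3 := by
    have := spec v₂; simp only [dist_self] at this; omega
  exact
  { le_five := fun u => by have := spec u; omega
    step := step
    center := hadj
    left := l₁
    right := l₂
    eq_left := fun {u} e => zero (by have := spec u; omega)
    eq_right := fun {u} e => zero (by have := spec u; omega)
    adj_left := fun {u} e => one (by have := spec u; omega)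
    adj_right := fun {u} e => one (by have := spec u; omega)
    exists_adj_left := fun {u} e => by
      obtain ⟨a, ha, -⟩ := hT.connected.exists_parent (z := v₁) (u := u)
        (by have := spec u; omega)
      exact ⟨a, ha⟩
    exists_adj_right := fun {u} e => by
      obtain ⟨a, ha, -⟩ := hT.connected.exists_parent (z := v₂) (u := u)
        (by have := spec u; omega)
      exact ⟨a, ha⟩
    parent_left := fun {u a b} e ha hb => by
      have := spec u; have := spec a; have := spec b; have := step ha; have := step hb
      exact hT.parent_unique (z := v₁) ha.symm hb.symm (by omega) (by omega)
    parent_right := fun {u a b} e ha hb => by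
      have := spec u; have := spec a; have := spec b; have := step ha; have := step hb
      exact hT.parent_unique (z := v₂) ha.symm hb.symm (by omega) (by omega)
    child_left := fun {a x y} hx hy ax ay => by
      have := spec a
      have := step ax
      exact child_unique (c := v₁) (hdeg a (by rintro rfl; omega) (by rintro rfl; omega))
        (one (by omega)) ax ay (by rintro rfl; omega) (by rintro rfl; omega) (Set.toFinite _)
    child_right := fun {a x y} hx hy ax ay => by
      have := spec a
      have := step ax
      exact child_unique (c := v₂) (hdeg a (by rintro rfl; omega) (by rintro rfl; omega))
        (one (by omega)) ax ay (by rintro rfl; omega) (by rintro rfl; omega) (Set.toFinite _) }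

theorem layer_of_edist_eq_five (hT : T.IsTree) (hadj : T.Adj v₁ v₂) (hecc₁ : ecc T v₁ = 3)
    (hecc₂ : ecc T v₂ = 3) {x u : V} (e : T.edist x u = 5) :
    layer T v₁ v₂ x = 0 ∧ layer T v₁ v₂ u = 5 ∨ layer T v₁ v₂ x = 5 ∧ layer T v₁ v₂ u = 0 := by
  rw [← (hT.connected x u).coe_dist_eq_edist] at e
  have e : T.dist x u = 5 := by exact_mod_cast e
  have h₁ := hT.connected.dist_triangle (u := x) (v := v₁) (w := u)
  have h₂ := hT.connected.dist_triangle (u := x) (v := v₂) (w := u)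
  rw [dist_comm (v := v₁)] at h₁
  rw [dist_comm (v := v₂)] at h₂
  have := layer_spec hT hadj hecc₁ hecc₂ x
  have := layer_spec hT hadj hecc₁ hecc₂ u
  omega

end Tree

theorem stmt5 [Fintype V] (T : SimpleGraph V) (hT : T.IsTree) (hdiam : T.ediam = 5)
    (v₁ v₂ : V) (hadj : T.Adj v₁ v₂) (hecc₁ : ecc T v₁ = 3) (hecc₂ : ecc T v₂ = 3)
    (hdeg : ∀ v : V, v ≠ v₁ → v ≠ v₂ → (T.neighborSet v).ncard ≤ 2)
    (hA : {x : V | ∃ u v : V, u ≠ v ∧ T.edist x u = 5 ∧ T.edist x v = 5}.Nontrivial) :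
    orientNum (vertexMult T (fun _ : V => 2)) = 6 := by
  have L := isLayering_layer hT hadj hecc₁ hecc₂ hdeg
  have five : ∀ {x u}, T.edist x u = 5 → _ := layer_of_edist_eq_five hT hadj hecc₁ hecc₂
  obtain ⟨x, ⟨u, v, uv, hu, hv⟩, y, ⟨u', v', uv', hu', hv'⟩, xy⟩ := hA
  rcases five hu with ⟨a, b⟩ | ⟨a, b⟩ <;> rcases five hv with ⟨a₂, c⟩ | ⟨a₂, c⟩ <;>
    rcases five hu' with ⟨a', b'⟩ | ⟨a', b'⟩ <;> rcases five hv' with ⟨a₂', c'⟩ | ⟨a₂', c'⟩ <;>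
    try omega
  · exact L.orientNum_eq_six a a' xy b c uv
  · exact L.orientNum_eq_six b' c' uv' b c uv
  · exact L.orientNum_eq_six b c uv b' c' uv'
  · exact L.orientNum_eq_six b c uv a a' xy
end

section
/- Let T be a tree of diameter 5 with vertex set {v_1, ..., v_n}, where v_1 and v_2 are its two central vertices (the two adjacent vertices of eccentricity 3), and let s_1, ..., s_n be integers with s_i ≥ 2 for all i and s_1 = s_2 = 2. Let D be an orientation of T(s_1, ..., s_n) with d(D) = 5. Then: (i) for every neighbour u of v_1 in T with u ≠ v_2 and every vertex x in the part V_u of the multiplication, x has at least one out-neighbour in D lying in the part V_{v_1} and at least one in-neighbour in D lying in V_{v_1}; and (ii) for every neighbour w of v_2 in T with w ≠ v_1 and every vertex y in the part V_w, y has at least one out-neighbour in D lying in V_{v_2} and at least one in-neighbour in D lying in V_{v_2}. -/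
open SimpleGraph

variable {V : Type*}

/-- In a tree, a non-backtracking step continues to move away from `z`. -/
lemma dist_eq_add_one_of_ne {T : SimpleGraph V} (hT : T.IsTree) {a b c z : V}
    (hba : T.Adj b a) (hbc : T.Adj b c) (hne : c ≠ a) (h : T.dist b z = T.dist a z + 1) :
    T.dist c z = T.dist b z + 1 := by
  have hstep := hT.dist_eq_dist_add_one_of_adj z hbc
  rw [T.dist_comm (u := z), T.dist_comm (u := z)] at hstep
  refine hstep.resolve_left fun h' => hne ?_
  obtain ⟨p, hp⟩ := hT.connected.exists_walk_length_eq_dist a z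
  obtain ⟨q, hq⟩ := hT.connected.exists_walk_length_eq_dist c z
  have hP : (Walk.cons hba p).IsPath :=
    Walk.isPath_of_length_eq_dist _ (by rw [Walk.length_cons]; lia)
  have hQ : (Walk.cons hbc q).IsPath :=
    Walk.isPath_of_length_eq_dist _ (by rw [Walk.length_cons]; lia)
  have heq := congrArg Subtype.val
    ((hT.isAcyclic.subsingleton_path _ _).elim ⟨_, hP⟩ ⟨_, hQ⟩)
  have := congrArg Walk.snd heq
  simpa using this.symm

lemma exists_dPath_le_of_odiam_le {D : V → V → Prop} {k : ℕ} (h : odiam D ≤ k) (x y : V) :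
    ∃ m ≤ k, DPath D m x y := by
  have hxy : ddist D x y ≤ k := (le_iSup₂ (f := fun u v => ddist D u v) x y).trans h
  have hne : {n : ℕ∞ | ∃ m : ℕ, n = (m : ℕ∞) ∧ DPath D m x y}.Nonempty := by
    by_contra hempty
    rw [Set.not_nonempty_iff_eq_empty] at hempty
    simp [ddist, hempty] at hxy
  obtain ⟨m, hm, hpath⟩ := csInf_mem hne
  refine ⟨m, ?_, hpath⟩
  rw [ddist, hm] at hxy
  exact_mod_cast hxy

lemma DPath.exists_last {D : V → V → Prop} {n : ℕ} {x y : V} (h : DPath D (n + 1) x y) :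
    ∃ w, DPath D n x w ∧ D w y := by
  induction n generalizing x with
  | zero =>
    obtain ⟨w, hw, rfl⟩ := h
    exact ⟨x, rfl, hw⟩
  | succ n ih =>
    obtain ⟨w, hw, hpath⟩ := h
    obtain ⟨t, ht, hty⟩ := ih hpath
    exact ⟨t, ⟨w, hw, ht⟩, hty⟩

lemma DPath.dist_le {T : SimpleGraph V} (hT : T.Connected) {s : V → ℕ}
    {D : (Σ v : V, Fin (s v)) → (Σ v : V, Fin (s v)) → Prop}
    (hD : ∀ x y, D x y → T.Adj x.1 y.1) {n : ℕ} {x y : Σ v : V, Fin (s v)}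
    (h : DPath D n x y) : T.dist x.1 y.1 ≤ n := by
  induction n generalizing x with
  | zero =>
    obtain rfl : x = y := h
    simp
  | succ n ih =>
    obtain ⟨w, hw, hpath⟩ := h
    have htri := hT.dist_triangle (u := x.1) (v := w.1) (w := y.1)
    have hone := dist_eq_one_iff_adj.mpr (hD x w hw)
    have := ih hpath
    lia

lemma exists_dist_eq_of_ecc_eq [Finite V] {T : SimpleGraph V} {v : V} {k : ℕ}
    (h : ecc T v = k) : ∃ z, T.dist v z = k := by
  obtain ⟨z, hz⟩ := T.exists_edist_eq_eccent_of_finite v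
  refine ⟨z, ?_⟩
  have : T.edist v z = k := hz.trans h
  simp [SimpleGraph.dist, this]

lemma dist_le_of_ecc_eq {T : SimpleGraph V} (hT : T.Connected) {v : V} {k : ℕ}
    (h : ecc T v = k) (z : V) : T.dist v z ≤ k := by
  have hle : T.edist v z ≤ k := h ▸ le_iSup (fun u => T.edist v u) z
  rw [← (hT v z).coe_dist_eq_edist] at hle
  exact_mod_cast hle

/-- A non-central neighbour `u` of a central vertex `v₁` is at distance `4` from a vertex `z` beyond
the other central vertex, so every short walk between copies of `u` and `z` passes `v₁` next
to `u`. -/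
lemma exists_out_and_in_neighbor_of_central [Finite V] {T : SimpleGraph V} (hT : T.IsTree)
    {v₁ v₂ : V} (hadj : T.Adj v₁ v₂) (hecc₁ : ecc T v₁ = 3) (hecc₂ : ecc T v₂ = 3)
    {s : V → ℕ} (hs : ∀ v, 0 < s v)
    {D : (Σ v : V, Fin (s v)) → (Σ v : V, Fin (s v)) → Prop}
    (hD : ∀ x y, D x y → T.Adj x.1 y.1) (hDdiam : odiam D ≤ 5)
    (x : Σ v : V, Fin (s v)) (hx : T.Adj v₁ x.1) (hne : x.1 ≠ v₂) :
    (∃ y : Σ v : V, Fin (s v), y.1 = v₁ ∧ D x y) ∧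
      (∃ y : Σ v : V, Fin (s v), y.1 = v₁ ∧ D y x) := by
  obtain ⟨z, hz⟩ := exists_dist_eq_of_ecc_eq (k := 3) hecc₁
  have hz₂ : T.dist v₁ z = T.dist v₂ z + 1 := by
    have hstep := hT.dist_eq_dist_add_one_of_adj z hadj
    rw [T.dist_comm (u := z), T.dist_comm (u := z)] at hstep
    have := dist_le_of_ecc_eq hT.connected (k := 3) hecc₂ z
    lia
  have hxz := dist_eq_add_one_of_ne hT hadj hx hne hz₂
  have key : ∀ c, T.Adj x.1 c → T.dist c z ≤ 4 → c = v₁ := by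
    intro c hc hle
    by_contra hcv
    have := dist_eq_add_one_of_ne hT hx.symm hc hcv hxz
    lia
  let ℓ : Σ v : V, Fin (s v) := ⟨z, 0, hs z⟩
  constructor
  · obtain ⟨m, hm, hpath⟩ := exists_dPath_le_of_odiam_le (k := 5) hDdiam x ℓ
    cases m with
    | zero =>
      have : T.dist x.1 z ≤ 0 := hpath.dist_le hT.connected hD
      lia
    | succ m =>
      obtain ⟨y, hxy, hy⟩ := hpath
      have : T.dist y.1 z ≤ m := hy.dist_le hT.connected hD
      exact ⟨y, key y.1 (hD x y hxy) (by lia), hxy⟩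
  · obtain ⟨m, hm, hpath⟩ := exists_dPath_le_of_odiam_le (k := 5) hDdiam ℓ x
    cases m with
    | zero =>
      have : T.dist z x.1 ≤ 0 := hpath.dist_le hT.connected hD
      rw [T.dist_comm] at this
      lia
    | succ m =>
      obtain ⟨y, hy, hyx⟩ := hpath.exists_last
      have : T.dist z y.1 ≤ m := hy.dist_le hT.connected hD
      rw [T.dist_comm] at this
      exact ⟨y, key y.1 (hD y x hyx).symm (by lia), hyx⟩

theorem stmt7 [Fintype V] (T : SimpleGraph V) (hT : T.IsTree) (hdiam : T.ediam = 5)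
    (v₁ v₂ : V) (hadj : T.Adj v₁ v₂) (hecc₁ : ecc T v₁ = 3) (hecc₂ : ecc T v₂ = 3)
    (s : V → ℕ) (hs : ∀ v, 2 ≤ s v) (hs₁ : s v₁ = 2) (hs₂ : s v₂ = 2)
    (D : (Σ v : V, Fin (s v)) → (Σ v : V, Fin (s v)) → Prop)
    (hD : IsOrientation (vertexMult T s) D) (hDdiam : odiam D = 5) :
    (∀ u : V, T.Adj v₁ u → u ≠ v₂ → ∀ x : Σ v : V, Fin (s v), x.1 = u →
      (∃ y : Σ v : V, Fin (s v), y.1 = v₁ ∧ D x y) ∧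
      (∃ y : Σ v : V, Fin (s v), y.1 = v₁ ∧ D y x)) ∧
    (∀ w : V, T.Adj v₂ w → w ≠ v₁ → ∀ x : Σ v : V, Fin (s v), x.1 = w →
      (∃ y : Σ v : V, Fin (s v), y.1 = v₂ ∧ D x y) ∧
      (∃ y : Σ v : V, Fin (s v), y.1 = v₂ ∧ D y x)) := by
  have hpos : ∀ v, 0 < s v := fun v => two_pos.trans_le (hs v)
  constructor
  · rintro u hu hne x rfl
    exact exists_out_and_in_neighbor_of_central hT hadj hecc₁ hecc₂ hpos hD.1 hDdiam.le x hu hne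
  · rintro u hu hne x rfl
    exact exists_out_and_in_neighbor_of_central hT hadj.symm hecc₂ hecc₁ hpos hD.1 hDdiam.le
      x hu hne
end
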